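/- Let B₀ ∈ ℝ³ be nonzero, b = B₀/‖B₀‖, let w ∈ ℝ³ satisfy w·b = 0, and let ū ∈ ℝ, x₀ ∈ ℝ³, ε ≠ 0. Let A(x) = (1/2)·B₀ × x (a vector potential for the constant field B₀), and let x̃(θ,t) = x₀ + t·ū·b + (ε/‖B₀‖)·(sin θ · w − cos θ · (w × b)), ṽ(θ,t) = ū·b + cos θ · w − sin θ · (b × w) be the rigid-ring solution of the loop-space Lorentz equations in the uniform field B₀. Then for every t, the normalized loop action satisfies (1/2π)·∫₀^{2π} ((1/ε)·A(x̃(θ,t)) + ṽ(θ,t)) · ∂_θ x̃(θ,t) dθ = ε·‖w‖²/(2·‖B₀‖); that is, the loop action equals ε times the magnetic moment μ₀ = ‖w‖²/(2·‖B₀‖) exactly in a uniform magnetic field. -/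

import Mathlib

open Real

noncomputable section

abbrev E3 : Type := EuclideanSpace ℝ (Fin 3)

/-- The cross product on `ℝ³`. -/
def cross (u v : E3) : E3 :=
  (WithLp.equiv 2 (Fin 3 → ℝ)).symm
    ![u 1 * v 2 - u 2 * v 1, u 2 * v 0 - u 0 * v 2, u 0 * v 1 - u 1 * v 0]

/-- The dot product on `ℝ³`. -/
def dot (u v : E3) : ℝ := u 0 * v 0 + u 1 * v 1 + u 2 * v 2

/-- The curl of a vector field on `ℝ³`, defined componentwise from the Fréchet derivative. -/
def curl (A : E3 → E3) (x : E3) : E3 :=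
  (WithLp.equiv 2 (Fin 3 → ℝ)).symm
    ![fderiv ℝ A x (EuclideanSpace.single 1 1) 2 - fderiv ℝ A x (EuclideanSpace.single 2 1) 1,
      fderiv ℝ A x (EuclideanSpace.single 2 1) 0 - fderiv ℝ A x (EuclideanSpace.single 0 1) 2,
      fderiv ℝ A x (EuclideanSpace.single 0 1) 1 - fderiv ℝ A x (EuclideanSpace.single 1 1) 0]

theorem dot_eq_inner (u v : E3) : dot u v = inner ℝ u v := by
  simp [dot, PiLp.inner_apply, Fin.sum_univ_three, mul_comm]

theorem dot_self_eq_norm_sq (u : E3) : dot u u = ‖u‖ ^ 2 := by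
  rw [dot_eq_inner, real_inner_self_eq_norm_sq]

theorem dot_add_left (u v w : E3) : dot (u + v) w = dot u w + dot v w := by
  simp only [dot_eq_inner, inner_add_left]

theorem dot_add_right (u v w : E3) : dot u (v + w) = dot u v + dot u w := by
  simp only [dot_eq_inner, inner_add_right]

theorem dot_smul_left (c : ℝ) (u v : E3) : dot (c • u) v = c * dot u v := by
  simp only [dot_eq_inner, real_inner_smul_left]

theorem dot_smul_right (c : ℝ) (u v : E3) : dot u (c • v) = c * dot u v := by
  simp only [dot_eq_inner, real_inner_smul_right]

theorem dot_comm (u v : E3) : dot u v = dot v u := by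
  simp only [dot]
  ring

theorem cross_anticomm_E3 (u v : E3) : cross u v = -cross v u := by
  ext i
  fin_cases i <;> simp [cross] <;> ring

theorem cross_self_E3 (u : E3) : cross u u = 0 := by
  ext i
  fin_cases i <;> simp [cross] <;> ring

theorem cross_add_right (u v w : E3) : cross u (v + w) = cross u v + cross u w := by
  ext i
  fin_cases i <;> simp [cross] <;> ring

theorem cross_sub_right (u v w : E3) : cross u (v - w) = cross u v - cross u w := by
  ext i
  fin_cases i <;> simp [cross] <;> ring

theorem cross_smul_left (c : ℝ) (u v : E3) : cross (c • u) v = c • cross u v := by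
  ext i
  fin_cases i <;> simp [cross] <;> ring

theorem cross_smul_right (c : ℝ) (u v : E3) : cross u (c • v) = c • cross u v := by
  ext i
  fin_cases i <;> simp [cross] <;> ring

theorem dot_cross_left (u v : E3) : dot u (cross u v) = 0 := by
  simp [dot, cross]
  ring

theorem dot_cross_right (u v : E3) : dot v (cross u v) = 0 := by
  simp [dot, cross]
  ring

theorem cross_cross_right (u v : E3) :
    cross v (cross u v) = dot v v • u - dot u v • v := by
  ext i
  fin_cases i <;> simp [dot, cross] <;> ring

theorem dot_cross_cross (u v : E3) :
    dot (cross u v) (cross u v) = dot u u * dot v v - dot u v ^ 2 := by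
  simp [dot, cross]
  ring

theorem hasDerivAt_ring (p u v : E3) (r θ : ℝ) :
    HasDerivAt (fun ϑ : ℝ => p + r • (sin ϑ • u - cos ϑ • v))
      (r • (cos θ • u + sin θ • v)) θ := by
  have h := ((((hasDerivAt_sin θ).smul_const u).sub
    ((hasDerivAt_cos θ).smul_const v)).const_smul r).const_add p
  simpa [neg_smul, sub_neg_eq_add] using h

theorem integral_trig_polynomial (P Q C : ℝ) :
    ∫ θ in (0:ℝ)..(2 * π), (P * cos θ + Q * sin θ + C) = 2 * π * C := by
  rw [intervalIntegral.integral_add, intervalIntegral.integral_add]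
  · simp
  all_goals exact Continuous.intervalIntegrable (by fun_prop) _ _

/-- For the rigid-ring solution of the loop-space Lorentz equations in a
uniform magnetic field `B₀` with vector potential `A(x) = (1/2)·B₀ × x`, the normalized
loop action equals `ε·μ₀` exactly, where `μ₀ = ‖w‖²/(2‖B₀‖)` is the magnetic moment. -/
theorem rigid_ring_loop_action
    (ε : ℝ) (hε : ε ≠ 0)
    (B₀ : E3) (hB₀ : B₀ ≠ 0)
    (b : E3) (hb : b = ‖B₀‖⁻¹ • B₀)
    (w : E3) (hw : dot w b = 0)
    (ubar : ℝ) (x₀ : E3)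
    (A : E3 → E3) (hA : ∀ x, A x = (1 / 2 : ℝ) • cross B₀ x)
    (xt vt : ℝ → ℝ → E3)
    (hxdef : ∀ θ t, xt θ t
      = x₀ + (t * ubar) • b + (ε / ‖B₀‖) • (sin θ • w - cos θ • cross w b))
    (hvdef : ∀ θ t, vt θ t = ubar • b + cos θ • w - sin θ • cross b w) :
    ∀ t : ℝ,
      (2 * π)⁻¹ * ∫ θ in (0:ℝ)..(2 * π),
        dot ((1 / ε) • A (xt θ t) + vt θ t) (deriv (fun ϑ => xt ϑ t) θ)
      = ε * (‖w‖ ^ 2 / (2 * ‖B₀‖)) := by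
  intro t
  have hn : ‖B₀‖ ≠ 0 := norm_ne_zero_iff.mpr hB₀
  have hB : B₀ = ‖B₀‖ • b := by rw [hb, smul_inv_smul₀ hn]
  have hbb : dot b b = 1 := by
    rw [dot_self_eq_norm_sq, hb, norm_smul, norm_inv, norm_norm, inv_mul_cancel₀ hn, one_pow]
  generalize ‖B₀‖ = n at *
  subst hB
  set f := cross w b with hf
  have hbw : cross b w = -f := cross_anticomm_E3 b w
  have hbf : cross b f = w := by rw [hf, cross_cross_right, hbb, hw]; simp
  have hwf : dot w f = 0 := dot_cross_left w b
  have hbf' : dot b f = 0 := dot_cross_right w b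
  have hff : dot f f = dot w w := by rw [hf, dot_cross_cross, hbb, hw]; ring
  have hderiv (θ : ℝ) : deriv (fun ϑ => xt ϑ t) θ = (ε / n) • (cos θ • w + sin θ • f) := by
    simp only [hxdef]
    exact (hasDerivAt_ring _ w f _ θ).deriv
  have hmomentum (θ : ℝ) : (1 / ε) • A (xt θ t) + vt θ t
      = (n / (2 * ε)) • cross b x₀ + ubar • b + (1 / 2 : ℝ) • (cos θ • w + sin θ • f) := by
    rw [hA, hxdef, hvdef, hbw]
    simp only [cross_smul_left, cross_add_right, cross_smul_right, cross_sub_right,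
      cross_self_E3, hbw, hbf]
    match_scalars <;> field_simp <;> ring
  have hintegrand (θ : ℝ) :
      dot ((1 / ε) • A (xt θ t) + vt θ t) (deriv (fun ϑ => xt ϑ t) θ)
      = dot (cross b x₀) w / 2 * cos θ + dot (cross b x₀) f / 2 * sin θ
        + ε * (dot w w / (2 * n)) := by
    rw [hderiv, hmomentum]
    simp only [dot_add_left, dot_add_right, dot_smul_left, dot_smul_right,
      dot_comm b w, dot_comm f w, hw, hwf, hbf', hff]
    field_simp
    linear_combination ε * dot w w * sin_sq_add_cos_sq θ
  simp only [hintegrand]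
  rw [integral_trig_polynomial, inv_mul_cancel_left₀ two_pi_pos.ne', dot_self_eq_norm_sq]

end
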